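/- Let p⃗ ∈ [1,∞]^m, let p be given by 1/p = Σ_{j=1}^m 1/p_j, assume p ≥ 1, and let w⃗ ∈ A_{p⃗} with w := ∏_{j=1}^m w_j. Let f_1,…,f_m be nonnegative measurable functions with ‖f_j‖_{L^{p_j}(ℝ^d)} = 1 for each j. Then there is a constant c, depending only on d, m and p⃗, such that: for every measurable E ⊆ ℝ^d with 0 < |E| < ∞ and every dyadic grid D, there exists a measurable E' ⊆ E with |E'| ≥ (1 − (2·3^d)^{-1})|E| such that for every (2·6^d)^{-1}-sparse collection S ⊆ D one has Σ_{Q∈S} ( ∏_{j=1}^m ⟨f_j w_j^{-1}⟩_{1,Q} ) ⟨w 1_{E'}⟩_{1,Q} |Q| ≤ c · [w^p]_FW · [w⃗]_{p⃗} · |E|^{1−1/p}. -/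

import Mathlib

open MeasureTheory ENNReal Set

noncomputable section

namespace Paper

variable {d m : ℕ}

abbrev Rd (d : ℕ) := Fin d → ℝ

structure Cube (d : ℕ) where
  corner : Rd d
  side : ℝ
  side_pos : 0 < side

def Cube.set (Q : Cube d) : Set (Rd d) :=
  {x | ∀ i, Q.corner i ≤ x i ∧ x i < Q.corner i + Q.side}

/-- the average `⟨f⟩_{q,Q}` for finite exponent `q`, of an `ℝ≥0∞`-valued function -/
def eAvg (f : Rd d → ℝ≥0∞) (q : ℝ) (Q : Cube d) : ℝ≥0∞ :=
  ((volume Q.set)⁻¹ * ∫⁻ x in Q.set, f x ^ q) ^ (1 / q)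

def ofFn (f : Rd d → ℝ) : Rd d → ℝ≥0∞ := fun x => ENNReal.ofReal |f x|

/-- the average `⟨f⟩_{q,Q}` for finite exponent `q > 0` -/
def avg (f : Rd d → ℝ) (q : ℝ) (Q : Cube d) : ℝ≥0∞ := eAvg (ofFn f) q Q

/-- the average `⟨f⟩_{q,Q}` for exponent `q ∈ (0,∞]` -/
def avgE (f : Rd d → ℝ) (q : ℝ≥0∞) (Q : Cube d) : ℝ≥0∞ :=
  if q = ∞ then essSup (ofFn f) (volume.restrict Q.set) else avg f q.toReal Q

def IsWeight (u : Rd d → ℝ) : Prop :=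
  MeasureTheory.LocallyIntegrable u volume ∧ ∀ᵐ x ∂(volume : Measure (Rd d)), 0 < u x

/-- `u(A) = ∫_A u dx` -/
def wMeas (u : Rd d → ℝ) (A : Set (Rd d)) : ℝ≥0∞ := ∫⁻ x in A, ENNReal.ofReal (u x)

/-- the Hardy–Littlewood maximal operator -/
def maximal (f : Rd d → ℝ) (x : Rd d) : ℝ≥0∞ :=
  ⨆ (Q : Cube d) (_ : x ∈ Q.set), avg f 1 Q

/-- the Fujii–Wilson constant `[u]_FW` -/
def FW (u : Rd d → ℝ) : ℝ≥0∞ :=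
  ⨆ Q : Cube d, (wMeas u Q.set)⁻¹ * ∫⁻ x in Q.set, maximal (Q.set.indicator u) x

/-- Hölder conjugate in `ℝ≥0∞` -/
def conj (q : ℝ≥0∞) : ℝ≥0∞ := (1 - q⁻¹)⁻¹

def prodW (w : Fin m → Rd d → ℝ) : Rd d → ℝ := fun x => ∏ j, w j x

/-- the two-weight multilinear Muckenhoupt constant `[w⃗,ω]_{p⃗}`; here `p0` is the
real number with `1/p0 = ∑ 1/p j`. -/
def APtw (p0 : ℝ) (p : Fin m → ℝ≥0∞) (w : Fin m → Rd d → ℝ) (ω : Rd d → ℝ) : ℝ≥0∞ :=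
  ⨆ Q : Cube d, avg ω p0 Q * ∏ j, avgE (fun x => (w j x)⁻¹) (conj (p j)) Q

/-- the multilinear Muckenhoupt constant `[w⃗]_{p⃗}` -/
def AP (p0 : ℝ) (p : Fin m → ℝ≥0∞) (w : Fin m → Rd d → ℝ) : ℝ≥0∞ :=
  APtw p0 p w (prodW w)

def IsSparse (η : ℝ) (S : Set (Cube d)) : Prop :=
  ∃ E : Cube d → Set (Rd d),
    (∀ Q ∈ S, E Q ⊆ Q.set ∧ MeasurableSet (E Q) ∧
      ENNReal.ofReal η * volume Q.set ≤ volume (E Q)) ∧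
    S.PairwiseDisjoint E

def dyadicGrid (d : ℕ) (α : Rd d) : Set (Cube d) :=
  {Q | ∃ (j : ℤ) (k : Fin d → ℤ),
    Q.side = (2:ℝ) ^ (-j) ∧ ∀ i, Q.corner i = (2:ℝ) ^ (-j) * (α i + k i)}

def IsDyadicGrid (D : Set (Cube d)) : Prop :=
  ∃ α : Rd d, (∀ i, α i = 0 ∨ α i = 1/3 ∨ α i = 2/3) ∧ D = dyadicGrid d α

/-- bounded, compactly supported, measurable -/
def BCS (f : Rd d → ℝ) : Prop :=
  Measurable f ∧ (∃ C, ∀ x, |f x| ≤ C) ∧ HasCompactSupport f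

def sparseForm (S : Set (Cube d)) (f : Fin m → Rd d → ℝ) (g : Rd d → ℝ) : ℝ≥0∞ :=
  ∑' Q : S, (∏ j, avg (f j) 1 Q.1) * avg g 1 Q.1 * volume (Q.1).set

def SparseFormDom (T : (Fin m → Rd d → ℝ) → Rd d → ℝ) (CT : ℝ≥0∞) : Prop :=
  ∀ (f : Fin m → Rd d → ℝ) (g : Rd d → ℝ), (∀ j, BCS (f j)) → BCS g →
    ∃ S : Set (Cube d), IsSparse (1/2) S ∧
      (∫⁻ x, ofFn (T f) x * ofFn g x) ≤ CT * sparseForm S f g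

/-- `‖f‖_{L^{p,∞}_u} = sup_{λ>0} λ (u^p({f > λ}))^{1/p}` for `ℝ≥0∞`-valued `f` -/
def eWeakNorm (u : Rd d → ℝ) (p : ℝ) (f : Rd d → ℝ≥0∞) : ℝ≥0∞ :=
  ⨆ (l : ℝ) (_ : 0 < l), ENNReal.ofReal l *
    (∫⁻ x in {x | ENNReal.ofReal l < f x}, ENNReal.ofReal (u x) ^ p) ^ (1/p)

def weakNorm (u : Rd d → ℝ) (p : ℝ) (f : Rd d → ℝ) : ℝ≥0∞ := eWeakNorm u p (ofFn f)

/-- `‖f‖_{L^p_u} = ‖fu‖_{L^p}` -/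
def LpW (u : Rd d → ℝ) (p : ℝ≥0∞) (f : Rd d → ℝ) : ℝ≥0∞ :=
  eLpNorm (fun x => f x * u x) p volume

lemma Cube.set_eq_pi (Q : Cube d) :
    Q.set = Set.pi univ fun i => Ico (Q.corner i) (Q.corner i + Q.side) := by
  ext x; simp [Cube.set]

lemma Cube.measurableSet (Q : Cube d) : MeasurableSet Q.set := by
  rw [Q.set_eq_pi]
  exact MeasurableSet.univ_pi fun _ => measurableSet_Ico

lemma Cube.volume_eq (Q : Cube d) : volume Q.set = ENNReal.ofReal Q.side ^ d := by
  rw [Q.set_eq_pi, Real.volume_pi_Ico]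
  simp

lemma Cube.volume_ne_zero (Q : Cube d) : volume Q.set ≠ 0 := by
  rw [Q.volume_eq]
  exact pow_ne_zero _ (by simpa using Q.side_pos)

lemma Cube.volume_ne_top (Q : Cube d) : volume Q.set ≠ ∞ := by
  rw [Q.volume_eq]
  exact pow_ne_top ofReal_ne_top

/-- The midpoint of a cube. -/
def Cube.center (Q : Cube d) : Rd d := fun i => Q.corner i + Q.side / 2

lemma Cube.set_subset_closedBall (Q : Cube d) :
    Q.set ⊆ Metric.closedBall Q.center (Q.side / 2) := by
  intro x hx
  rw [Metric.mem_closedBall, dist_pi_le_iff (by linarith [Q.side_pos])]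
  intro i
  rw [Real.dist_eq, abs_le, Cube.center]
  constructor <;> linarith [(hx i).1, (hx i).2]

lemma Cube.volume_closedBall (Q : Cube d) :
    volume (Metric.closedBall Q.center (5 * (Q.side / 2))) = 5 ^ d * volume Q.set := by
  have hs := Q.side_pos
  rw [Real.volume_pi_closedBall _ (by positivity), Q.volume_eq, Fintype.card_fin,
    show 2 * (5 * (Q.side / 2)) = 5 * Q.side by ring, ENNReal.ofReal_pow (by positivity),
    ENNReal.ofReal_mul (by norm_num), mul_pow]
  norm_num

lemma Cube.interior_closedBall_nonempty (Q : Cube d) :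
    (interior (Metric.closedBall Q.center (Q.side / 2))).Nonempty :=
  ⟨Q.center, Metric.ball_subset_interior_closedBall
    (Metric.mem_ball_self (by linarith [Q.side_pos]))⟩

/-- The weak-type `(1,1)` bound for the maximal operator over cubes, applied to a finite measure. -/
lemma volume_iUnion_cubes_le (hd : 1 ≤ d) (κ : Measure (Rd d)) [IsFiniteMeasure κ] (t : ℝ≥0∞)
    (ht : t ≠ 0) (ht' : t ≠ ∞) :
    volume (⋃ Q ∈ {Q : Cube d | t * volume Q.set < κ Q.set}, Q.set) ≤
      5 ^ d * t⁻¹ * κ univ := by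
  set T := {Q : Cube d | t * volume Q.set < κ Q.set} with hT
  have hK : t⁻¹ * κ univ ≠ ∞ := mul_ne_top (inv_ne_top.2 ht) (measure_ne_top _ _)
  have hbound : ∀ Q ∈ T, Q.side / 2 ≤ 1 + (t⁻¹ * κ univ).toReal := by
    intro Q hQ
    have h1 : volume Q.set ≤ t⁻¹ * κ univ := by
      rw [← ENNReal.div_eq_inv_mul, ENNReal.le_div_iff_mul_le (Or.inl ht) (Or.inl ht'), mul_comm]
      exact hQ.le.trans (measure_mono (subset_univ _))
    rw [Q.volume_eq, ← ENNReal.ofReal_pow Q.side_pos.le] at h1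
    have h2 : Q.side ^ d ≤ (t⁻¹ * κ univ).toReal := (ENNReal.ofReal_le_iff_le_toReal hK).1 h1
    have hs := Q.side_pos
    rcases le_total Q.side 1 with h | h
    · have : (0 : ℝ) ≤ (t⁻¹ * κ univ).toReal := ENNReal.toReal_nonneg
      linarith
    · have : Q.side ≤ Q.side ^ d := le_self_pow₀ h (by omega)
      linarith
  obtain ⟨u, huT, hdisj, hcov⟩ := Vitali.exists_disjoint_subfamily_covering_enlargement_closedBall T
    Cube.center (fun Q => Q.side / 2) _ hbound 5 (by norm_num)
  have hcount : u.Countable :=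
    hdisj.countable_of_nonempty_interior fun Q _ => Q.interior_closedBall_nonempty
  have hdisj' : u.PairwiseDisjoint Cube.set := fun Q hQ R hR h =>
    (hdisj hQ hR h).mono Q.set_subset_closedBall R.set_subset_closedBall
  have : Countable u := hcount.to_subtype
  calc volume (⋃ Q ∈ T, Q.set)
      ≤ volume (⋃ Q : u, Metric.closedBall Q.1.center (5 * (Q.1.side / 2))) := by
        refine measure_mono (iUnion₂_subset fun Q hQ => ?_)
        obtain ⟨R, hR, h⟩ := hcov Q hQ
        exact (Q.set_subset_closedBall.trans h).trans
          (subset_iUnion (fun Q : u => Metric.closedBall Q.1.center (5 * (Q.1.side / 2))) ⟨R, hR⟩)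
    _ ≤ ∑' Q : u, volume (Metric.closedBall Q.1.center (5 * (Q.1.side / 2))) :=
        measure_iUnion_le _
    _ ≤ ∑' Q : u, 5 ^ d * t⁻¹ * κ Q.1.set := by
        refine ENNReal.tsum_le_tsum fun Q => ?_
        rw [Q.1.volume_closedBall, mul_assoc]
        gcongr
        rw [← ENNReal.div_eq_inv_mul, ENNReal.le_div_iff_mul_le (Or.inl ht) (Or.inl ht'), mul_comm]
        exact (huT Q.2).le
    _ = 5 ^ d * t⁻¹ * ∑' Q : u, κ Q.1.set := ENNReal.tsum_mul_left
    _ ≤ 5 ^ d * t⁻¹ * κ univ := by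
        gcongr
        exact (tsum_meas_le_meas_iUnion_of_disjoint κ (fun Q : u => Q.1.measurableSet)
          (fun Q R h => hdisj' Q.2 R.2 (Subtype.coe_injective.ne h))).trans
          (measure_mono (subset_univ _))

/-- Sparse families are Carleson: volumes sum to at most a multiple of the volume of the union. -/
lemma IsSparse.tsum_volume_le {η : ℝ} (hη : 0 < η) {S : Set (Cube d)} (hS : IsSparse η S)
    (P : Cube d → Prop) [DecidablePred P] :
    ∑' Q : S, (if P Q.1 then volume Q.1.set else 0) ≤
      (ENNReal.ofReal η)⁻¹ * volume (⋃ Q ∈ {Q : Cube d | P Q}, Q.set) := by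
  obtain ⟨E, hE, hdisj⟩ := hS
  have h0 : ENNReal.ofReal η ≠ 0 := by simpa using hη
  calc ∑' Q : S, (if P Q.1 then volume Q.1.set else 0)
      ≤ ∑' Q : S, (ENNReal.ofReal η)⁻¹ * volume (if P Q.1 then E Q.1 else ∅) := by
        refine ENNReal.tsum_le_tsum fun Q => ?_
        split_ifs with h
        · rw [← ENNReal.div_eq_inv_mul,
            ENNReal.le_div_iff_mul_le (Or.inl h0) (Or.inl ofReal_ne_top), mul_comm]
          exact (hE Q Q.2).2.2
        · simp
    _ = (ENNReal.ofReal η)⁻¹ * ∑' Q : S, volume (if P Q.1 then E Q.1 else ∅) :=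
        ENNReal.tsum_mul_left
    _ ≤ (ENNReal.ofReal η)⁻¹ * volume (⋃ Q ∈ {Q : Cube d | P Q}, Q.set) := by
        gcongr
        refine (tsum_meas_le_meas_iUnion_of_disjoint volume (fun Q : S => ?_)
          (fun Q R h => ?_)).trans (measure_mono (iUnion_subset fun Q => ?_))
        · split_ifs
          · exact (hE Q Q.2).2.1
          · exact MeasurableSet.empty
        · have := hdisj Q.2 R.2 (Subtype.coe_injective.ne h)
          simp only [Function.onFun] at this ⊢
          split_ifs <;> simp [this]
        · split_ifs with h
          · exact (hE Q Q.2).1.trans (subset_biUnion_of_mem (u := Cube.set) h)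
          · exact empty_subset _

/-- The dyadic subcube of generation `n` and index `k` of the grid generated by `Q`. -/
def Cube.sub (Q : Cube d) (i : ℕ × (Fin d → ℤ)) : Cube d where
  corner a := Q.corner a + Q.side / 2 ^ i.1 * i.2 a
  side := Q.side / 2 ^ i.1
  side_pos := div_pos Q.side_pos (by positivity)

lemma Cube.mem_sub (Q : Cube d) (i : ℕ × (Fin d → ℤ)) (x : Rd d) :
    x ∈ (Q.sub i).set ↔ ∀ a, ⌊(x a - Q.corner a) / Q.side * 2 ^ i.1⌋ = i.2 a := by
  refine forall_congr' fun a => ?_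
  have hs : 0 < Q.side / 2 ^ i.1 := (Q.sub i).side_pos
  have hx : (x a - Q.corner a) / Q.side * 2 ^ i.1 = (x a - Q.corner a) / (Q.side / 2 ^ i.1) := by
    have := Q.side_pos.ne'
    field_simp
  rw [Int.floor_eq_iff, hx, le_div_iff₀ hs, div_lt_iff₀ hs]
  simp only [Cube.sub]
  constructor <;> rintro ⟨h1, h2⟩ <;> constructor <;> nlinarith

lemma Cube.exists_mem_sub (Q : Cube d) (n : ℕ) (x : Rd d) : ∃ k, x ∈ (Q.sub (n, k)).set :=
  ⟨fun a => ⌊(x a - Q.corner a) / Q.side * 2 ^ n⌋, (Q.mem_sub _ _).2 fun _ => rfl⟩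

lemma Cube.sub_zero_set (Q : Cube d) : (Q.sub (0, 0)).set = Q.set := by
  simp [Cube.sub, Cube.set]

lemma Cube.volume_sub (Q : Cube d) (i : ℕ × (Fin d → ℤ)) :
    2 ^ (d * i.1) * volume (Q.sub i).set = volume Q.set := by
  rw [(Q.sub i).volume_eq, Q.volume_eq, mul_comm d, pow_mul, ← mul_pow]
  congr 1
  rw [show (2 : ℝ≥0∞) ^ i.1 = ENNReal.ofReal (2 ^ i.1) by
    rw [ENNReal.ofReal_pow (by norm_num)]; norm_num, ← ENNReal.ofReal_mul (by positivity)]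
  congr 1
  simp only [Cube.sub]
  field_simp

lemma Cube.sub_subset (Q : Cube d) {i j : ℕ × (Fin d → ℤ)} (hij : i.1 ≤ j.1)
    (h : ((Q.sub i).set ∩ (Q.sub j).set).Nonempty) : (Q.sub j).set ⊆ (Q.sub i).set := by
  obtain ⟨x, hxi, hxj⟩ := h
  intro y hy
  rw [Q.mem_sub] at hxi hxj hy ⊢
  have key : ∀ z : ℝ, ⌊z * 2 ^ i.1⌋ = ⌊z * 2 ^ j.1⌋ / ((2 ^ (j.1 - i.1) : ℕ) : ℤ) := by
    intro z
    rw [← Int.floor_div_natCast]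
    congr 1
    push_cast
    rw [_root_.eq_div_iff (by positivity), mul_assoc, ← pow_add, Nat.add_sub_cancel' hij]
  intro a
  rw [← hxi a, key, key, hy a, hxj a]

lemma Cube.sub_eq (Q : Cube d) {i j : ℕ × (Fin d → ℤ)} (hij : i.1 = j.1)
    (h : ((Q.sub i).set ∩ (Q.sub j).set).Nonempty) : i = j := by
  obtain ⟨x, hxi, hxj⟩ := h
  rw [Q.mem_sub] at hxi hxj
  refine Prod.ext hij (funext fun a => ?_)
  rw [← hxi a, ← hxj a, hij]

/-- The dyadic subcubes in which `A` has density larger than `2^{-(d+1)}`. -/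
def Cube.good (Q : Cube d) (A : Set (Rd d)) : Set (ℕ × (Fin d → ℤ)) :=
  {i | volume (Q.sub i).set < 2 ^ (d + 1) * volume (A ∩ (Q.sub i).set)}

/-- The maximal elements of `Q.good A`. -/
def Cube.maxGood (Q : Cube d) (A : Set (Rd d)) : Set (ℕ × (Fin d → ℤ)) :=
  {i ∈ Q.good A | ∀ j ∈ Q.good A, j.1 < i.1 → Disjoint (Q.sub j).set (Q.sub i).set}

/-- The union of the dyadic subcubes in which `A` has density larger than `2^{-(d+1)}`. -/
def Cube.expand (Q : Cube d) (A : Set (Rd d)) : Set (Rd d) := ⋃ i ∈ Q.good A, (Q.sub i).set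

lemma Cube.good_mono (Q : Cube d) {A B : Set (Rd d)} (h : A ⊆ B) : Q.good A ⊆ Q.good B :=
  fun i hi => lt_of_lt_of_le (a := volume (Q.sub i).set) hi (by gcongr)

lemma Cube.expand_mono (Q : Cube d) {A B : Set (Rd d)} (h : A ⊆ B) : Q.expand A ⊆ Q.expand B :=
  biUnion_subset_biUnion_left (Q.good_mono h)

lemma Cube.measurableSet_expand (Q : Cube d) (A : Set (Rd d)) : MeasurableSet (Q.expand A) :=
  MeasurableSet.biUnion (to_countable _) fun i _ => (Q.sub i).measurableSet

lemma Cube.pairwise_disjoint_maxGood (Q : Cube d) (A : Set (Rd d)) :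
    Pairwise fun i j : Q.maxGood A => Disjoint (Q.sub i.1).set (Q.sub j.1).set := by
  intro i j hij
  rcases lt_trichotomy i.1.1 j.1.1 with h | h | h
  · exact j.2.2 i i.2.1 h
  · by_contra hd
    exact hij (Subtype.ext (Q.sub_eq h (not_disjoint_iff_nonempty_inter.1 hd)))
  · exact (i.2.2 j j.2.1 h).symm

lemma Cube.exists_maxGood (Q : Cube d) (A : Set (Rd d)) (x : Rd d) :
    ∀ n : ℕ, ∀ i ∈ Q.good A, i.1 = n → x ∈ (Q.sub i).set →
      ∃ j ∈ Q.maxGood A, x ∈ (Q.sub j).set := by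
  intro n
  induction n using Nat.strong_induction_on with
  | _ n ih =>
    intro i hi hin hx
    by_cases h : i ∈ Q.maxGood A
    · exact ⟨i, h, hx⟩
    · have : ∃ j ∈ Q.good A, j.1 < i.1 ∧ ¬ Disjoint (Q.sub j).set (Q.sub i).set := by
        by_contra! hc
        exact h ⟨hi, hc⟩
      obtain ⟨j, hj, hji, hd⟩ := this
      exact ih j.1 (hin ▸ hji) j hj rfl
        (Q.sub_subset hji.le (not_disjoint_iff_nonempty_inter.1 hd) hx)

lemma Cube.expand_eq (Q : Cube d) (A : Set (Rd d)) :
    Q.expand A = ⋃ i : Q.maxGood A, (Q.sub i.1).set := by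
  ext x
  simp only [Cube.expand, mem_iUnion]
  constructor
  · rintro ⟨i, hi, hx⟩
    obtain ⟨j, hj, hxj⟩ := Q.exists_maxGood A x _ i hi rfl hx
    exact ⟨⟨j, hj⟩, hxj⟩
  · rintro ⟨i, hx⟩
    exact ⟨i.1, i.2.1, hx⟩

lemma Cube.measure_expand_inter (Q : Cube d) (A B : Set (Rd d)) (hB : MeasurableSet B)
    (μ : Measure (Rd d)) :
    μ (Q.expand A ∩ B) = ∑' i : Q.maxGood A, μ ((Q.sub i.1).set ∩ B) := by
  rw [Q.expand_eq, iUnion_inter, measure_iUnion]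
  · exact fun i j h => (Q.pairwise_disjoint_maxGood A h).mono inter_subset_left inter_subset_left
  · exact fun i => (Q.sub i.1).measurableSet.inter hB

lemma Cube.volume_expand_le (Q : Cube d) {A : Set (Rd d)} (hA : MeasurableSet A) :
    volume (Q.expand A) ≤ 2 ^ (d + 1) * volume A := by
  have h := Q.measure_expand_inter A univ MeasurableSet.univ volume
  simp only [inter_univ] at h
  calc volume (Q.expand A)
      ≤ ∑' i : Q.maxGood A, 2 ^ (d + 1) * volume (A ∩ (Q.sub i.1).set) := by
        rw [h]
        exact ENNReal.tsum_le_tsum fun i => le_of_lt i.2.1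
    _ = 2 ^ (d + 1) * ∑' i : Q.maxGood A, volume (A ∩ (Q.sub i.1).set) := ENNReal.tsum_mul_left
    _ ≤ 2 ^ (d + 1) * volume A := by
        gcongr
        refine (tsum_meas_le_meas_iUnion_of_disjoint volume
          (fun i : Q.maxGood A => hA.inter (Q.sub i.1).measurableSet) (fun i j h => ?_)).trans
          (measure_mono (iUnion_subset fun _ => inter_subset_left))
        exact (Q.pairwise_disjoint_maxGood A h).mono inter_subset_right inter_subset_right

lemma Cube.volume_inter_maxGood_le (Q : Cube d) {A : Set (Rd d)}
    (hA : 2 ^ (d + 1) * volume A ≤ volume Q.set) {i : ℕ × (Fin d → ℤ)} (hi : i ∈ Q.maxGood A) :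
    2 * volume (A ∩ (Q.sub i).set) ≤ volume (Q.sub i).set := by
  obtain ⟨n, k⟩ := i
  have hgood : volume (Q.sub (n, k)).set < 2 ^ (d + 1) * volume (A ∩ (Q.sub (n, k)).set) := hi.1
  rcases n with _ | n
  · exfalso
    have h1 := Q.volume_sub (0, k)
    simp only [mul_zero, pow_zero, one_mul] at h1
    rw [h1] at hgood
    refine absurd (hgood.trans_le ?_) hA.not_gt
    gcongr
    exact inter_subset_left
  · obtain ⟨x, hx⟩ : ((A ∩ (Q.sub (n + 1, k)).set)).Nonempty := by
      by_contra hc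
      rw [not_nonempty_iff_eq_empty] at hc
      simp [hc] at hgood
    obtain ⟨l, hl⟩ := Q.exists_mem_sub n x
    have hsub : (Q.sub (n + 1, k)).set ⊆ (Q.sub (n, l)).set :=
      Q.sub_subset (Nat.le_succ n) ⟨x, hl, hx.2⟩
    have hbad : (n, l) ∉ Q.good A := fun hg =>
      disjoint_left.1 (hi.2 _ hg (Nat.lt_succ_self n)) hl hx.2
    simp only [Cube.good, mem_ofPred_eq, not_lt] at hbad
    have hv : volume (Q.sub (n, l)).set = 2 ^ d * volume (Q.sub (n + 1, k)).set := by
      have h1 := Q.volume_sub (n, l)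
      rw [← Q.volume_sub (n + 1, k)] at h1
      simp only [Nat.mul_succ, pow_add, mul_assoc] at h1
      exact (ENNReal.mul_right_inj (by positivity) (by simp)).1 h1
    rw [hv, pow_succ, mul_assoc] at hbad
    have := (ENNReal.mul_le_mul_iff_right (by positivity) (by simp)).1 hbad
    refine le_trans ?_ this
    gcongr

lemma Cube.sub_subset_of_maxGood (Q : Cube d) {A B : Set (Rd d)} (hAB : A ⊆ B)
    {i j : ℕ × (Fin d → ℤ)} (hi : i ∈ Q.maxGood A) (hj : j ∈ Q.maxGood B)
    (h : ((Q.sub i).set ∩ (Q.sub j).set).Nonempty) : (Q.sub i).set ⊆ (Q.sub j).set := by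
  rcases lt_or_ge i.1 j.1 with hij | hij
  · exact absurd (hj.2 i (Q.good_mono hAB hi.1) hij) (not_disjoint_iff_nonempty_inter.2 h)
  · exact Q.sub_subset hij (inter_comm _ _ ▸ h)

lemma Cube.expand_subset (Q : Cube d) {A : Set (Rd d)} (hA : A ⊆ Q.set) : Q.expand A ⊆ Q.set := by
  refine iUnion₂_subset fun i hi => ?_
  have hne : (A ∩ (Q.sub i).set).Nonempty := by
    by_contra hc
    rw [not_nonempty_iff_eq_empty] at hc
    simp [Cube.good, hc] at hi
  rw [← Q.sub_zero_set] at hA ⊢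
  exact Q.sub_subset (Nat.zero_le _) (hne.mono (inter_subset_inter_left _ hA))

lemma Cube.exists_sub_subset (Q : Cube d) {U : Set (Rd d)} (hU : IsOpen U) {x : Rd d}
    (hxU : x ∈ U) (hxQ : x ∈ Q.set) : ∃ i, x ∈ (Q.sub i).set ∧ (Q.sub i).set ⊆ U ∩ Q.set := by
  obtain ⟨ε, hε, hball⟩ := Metric.isOpen_iff.1 hU x hxU
  obtain ⟨n, hn⟩ := exists_pow_lt_of_lt_one (div_pos hε Q.side_pos) (one_half_lt_one (α := ℝ))
  obtain ⟨k, hk⟩ := Q.exists_mem_sub n x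
  refine ⟨(n, k), hk, subset_inter (fun y hy => hball ?_) ?_⟩
  · have hlt : Q.side / 2 ^ n < ε := by
      rw [lt_div_iff₀ Q.side_pos] at hn
      calc Q.side / 2 ^ n = (1 / 2) ^ n * Q.side := by rw [one_div_pow]; ring
        _ < ε := hn
    rw [Metric.mem_ball, dist_pi_lt_iff hε]
    intro a
    have h1 := hk a
    have h2 := hy a
    simp only [Cube.sub] at h1 h2
    rw [Real.dist_eq, abs_lt]
    constructor <;> linarith [h1.1, h1.2, h2.1, h2.2]
  · rw [← Q.sub_zero_set] at hxQ ⊢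
    exact Q.sub_subset (Nat.zero_le _) ⟨x, hxQ, hk⟩

lemma Cube.inter_subset_expand (Q : Cube d) {U : Set (Rd d)} (hU : IsOpen U) :
    U ∩ Q.set ⊆ Q.expand (U ∩ Q.set) := by
  rintro x ⟨hxU, hxQ⟩
  obtain ⟨i, hxi, hi⟩ := Q.exists_sub_subset hU hxU hxQ
  refine mem_biUnion (x := i) ?_ hxi
  rw [Cube.good, mem_ofPred_eq, inter_eq_self_of_subset_right hi]
  calc volume (Q.sub i).set = 1 * volume (Q.sub i).set := (one_mul _).symm
    _ < 2 ^ (d + 1) * volume (Q.sub i).set :=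
      ENNReal.mul_lt_mul_left (Q.sub i).volume_ne_zero (Q.sub i).volume_ne_top
        (one_lt_pow₀ (by norm_num) (by omega))

/-- The measure with density `u`. -/
def weightMeasure (u : Rd d → ℝ) : Measure (Rd d) :=
  volume.withDensity fun x => ENNReal.ofReal (u x)

lemma wMeas_eq (u : Rd d → ℝ) {A : Set (Rd d)} (hA : MeasurableSet A) :
    wMeas u A = weightMeasure u A :=
  (withDensity_apply _ hA).symm

lemma avg_one (g : Rd d → ℝ) (Q : Cube d) :
    avg g 1 Q = (volume Q.set)⁻¹ * ∫⁻ x in Q.set, ofFn g x := by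
  simp [avg, eAvg]

lemma le_maximal_indicator (u : Rd d → ℝ) {R Q : Cube d} (hRQ : R.set ⊆ Q.set) {x : Rd d}
    (hx : x ∈ R.set) :
    (volume R.set)⁻¹ * weightMeasure u R.set ≤ maximal (Q.set.indicator u) x := by
  refine le_trans ?_ (le_iSup₂ (f := fun (S : Cube d) (_ : x ∈ S.set) =>
    avg (Q.set.indicator u) 1 S) R hx)
  rw [avg_one, ← wMeas_eq u R.measurableSet, wMeas]
  refine mul_le_mul_right (setLIntegral_mono' R.measurableSet fun y hy => ?_) _
  rw [ofFn, indicator_of_mem (hRQ hy)]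
  exact ENNReal.ofReal_le_ofReal (le_abs_self _)

lemma lintegral_maximal_le (u : Rd d → ℝ) (Q : Cube d) (h0 : weightMeasure u Q.set ≠ 0)
    (htop : weightMeasure u Q.set ≠ ∞) :
    ∫⁻ x in Q.set, maximal (Q.set.indicator u) x ≤ FW u * weightMeasure u Q.set := by
  have h := le_iSup (fun R : Cube d => (wMeas u R.set)⁻¹ *
    ∫⁻ x in R.set, maximal (R.set.indicator u) x) Q
  simp only [wMeas_eq u Q.measurableSet] at h
  rwa [← ENNReal.div_eq_inv_mul, ENNReal.div_le_iff h0 htop] at h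

lemma one_le_FW (u : Rd d → ℝ) (Q : Cube d) (h0 : weightMeasure u Q.set ≠ 0)
    (htop : weightMeasure u Q.set ≠ ∞) : 1 ≤ FW u := by
  have h1 : weightMeasure u Q.set ≤ ∫⁻ x in Q.set, maximal (Q.set.indicator u) x := by
    calc weightMeasure u Q.set
        = ∫⁻ _ in Q.set, (volume Q.set)⁻¹ * weightMeasure u Q.set := by
          rw [setLIntegral_const, mul_right_comm,
            ENNReal.inv_mul_cancel Q.volume_ne_zero Q.volume_ne_top, one_mul]
      _ ≤ _ := setLIntegral_mono' Q.measurableSet fun x hx =>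
          le_maximal_indicator u subset_rfl hx
  have h2 := h1.trans (lintegral_maximal_le u Q h0 htop)
  by_contra! h
  exact absurd h2 (not_le.2 (by
    simpa using ENNReal.mul_lt_mul_left h0 htop h))

lemma Cube.weight_le_lintegral_maximal_sdiff (u : Rd d → ℝ) {P R : Cube d} (hPR : P.set ⊆ R.set)
    {A : Set (Rd d)} (hA : MeasurableSet A) (hhalf : 2 * volume (A ∩ P.set) ≤ volume P.set) :
    weightMeasure u P.set ≤ 2 * ∫⁻ x in P.set \ A, maximal (R.set.indicator u) x := by
  have hdiff : volume P.set ≤ 2 * volume (P.set \ A) := by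
    have h1 : volume (A ∩ P.set) + volume (P.set \ A) = volume P.set := by
      rw [inter_comm]; exact measure_inter_add_sdiff _ hA
    have hfin : volume (A ∩ P.set) ≠ ∞ :=
      ne_top_of_le_ne_top P.volume_ne_top (measure_mono inter_subset_right)
    have h2 : volume (A ∩ P.set) ≤ volume (P.set \ A) := by
      rw [← h1, two_mul] at hhalf
      exact (ENNReal.add_le_add_iff_left hfin).1 hhalf
    rw [← h1, two_mul]
    gcongr
  calc weightMeasure u P.set
      = (volume P.set)⁻¹ * weightMeasure u P.set * volume P.set := by
        rw [mul_right_comm, ENNReal.inv_mul_cancel P.volume_ne_zero P.volume_ne_top, one_mul]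
    _ ≤ (volume P.set)⁻¹ * weightMeasure u P.set * (2 * volume (P.set \ A)) := by gcongr
    _ = 2 * ∫⁻ _ in P.set \ A, (volume P.set)⁻¹ * weightMeasure u P.set := by
        rw [setLIntegral_const]; ring
    _ ≤ 2 * ∫⁻ x in P.set \ A, maximal (R.set.indicator u) x :=
        mul_le_mul_right (setLIntegral_mono' (P.measurableSet.diff hA) fun x hx =>
          le_maximal_indicator u hPR hx.1) _

lemma Cube.lintegral_expand_diff_inter (Q R : Cube d) {A : Set (Rd d)} (hA : MeasurableSet A)
    (g : Rd d → ℝ≥0∞) :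
    ∫⁻ x in (Q.expand A \ A) ∩ R.set, g x =
      ∑' i : Q.maxGood A, ∫⁻ x in ((Q.sub i.1).set \ A) ∩ R.set, g x := by
  have hm : ∀ i : Q.maxGood A, MeasurableSet (((Q.sub i.1).set \ A) ∩ R.set) := fun i =>
    ((Q.sub i.1).measurableSet.diff hA).inter R.measurableSet
  have hdisj : Pairwise (Function.onFun Disjoint fun i : Q.maxGood A =>
      ((Q.sub i.1).set \ A) ∩ R.set) := fun i k h =>
    disjoint_left.2 fun x hx hy =>
      disjoint_left.1 (Q.pairwise_disjoint_maxGood A h) hx.1.1 hy.1.1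
  rw [Q.expand_eq, iUnion_sdiff, iUnion_inter]
  exact lintegral_iUnion hm hdisj g

lemma Cube.weight_expand_inter_le (Q : Cube d) (u : Rd d → ℝ) {A B : Set (Rd d)} (hAB : A ⊆ B)
    (hA : MeasurableSet A) (hAv : 2 ^ (d + 1) * volume A ≤ volume Q.set)
    {j : ℕ × (Fin d → ℤ)} (hj : j ∈ Q.maxGood B) :
    weightMeasure u (Q.expand A ∩ (Q.sub j).set) ≤
      2 * ∫⁻ x in (Q.expand A \ A) ∩ (Q.sub j).set,
        maximal ((Q.sub j).set.indicator u) x := by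
  rw [Q.measure_expand_inter A _ (Q.sub j).measurableSet, Q.lintegral_expand_diff_inter _ hA,
    ← ENNReal.tsum_mul_left]
  refine ENNReal.tsum_le_tsum fun i => ?_
  rcases ((Q.sub i.1).set ∩ (Q.sub j).set).eq_empty_or_nonempty with h | h
  · simp only [h, measure_empty, zero_le]
  have hsub : (Q.sub i.1).set ⊆ (Q.sub j).set := Q.sub_subset_of_maxGood hAB i.2 hj h
  rw [inter_eq_self_of_subset_left hsub, inter_eq_self_of_subset_left (sdiff_subset.trans hsub)]
  exact Cube.weight_le_lintegral_maximal_sdiff u hsub hA (Q.volume_inter_maxGood_le hAv i.2)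

/-- Iterated expansions of a set inside the dyadic grid generated by `Q`. -/
def Cube.iterExpand (Q : Cube d) (A : Set (Rd d)) : ℕ → Set (Rd d)
  | 0 => A
  | n + 1 => Q.expand (Q.iterExpand A n)

lemma Cube.measurableSet_iterExpand (Q : Cube d) {A : Set (Rd d)} (hA : MeasurableSet A) (n : ℕ) :
    MeasurableSet (Q.iterExpand A n) := by
  cases n with
  | zero => exact hA
  | succ n => exact Q.measurableSet_expand _

lemma Cube.iterExpand_subset (Q : Cube d) {A : Set (Rd d)} (hA : A ⊆ Q.set) (n : ℕ) :
    Q.iterExpand A n ⊆ Q.set := by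
  induction n with
  | zero => exact hA
  | succ n ih => exact Q.expand_subset ih

lemma Cube.monotone_iterExpand (Q : Cube d) {A : Set (Rd d)} (hA : A ⊆ Q.expand A) :
    Monotone (Q.iterExpand A) := by
  refine monotone_nat_of_le_succ fun n => ?_
  induction n with
  | zero => exact hA
  | succ n ih => exact Q.expand_mono ih

lemma Cube.volume_iterExpand_le (Q : Cube d) {A : Set (Rd d)} (hA : MeasurableSet A) (n : ℕ) :
    volume (Q.iterExpand A n) ≤ 2 ^ ((d + 1) * n) * volume A := by
  induction n with
  | zero => simp [Cube.iterExpand]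
  | succ n ih =>
    calc volume (Q.expand (Q.iterExpand A n))
        ≤ 2 ^ (d + 1) * volume (Q.iterExpand A n) :=
          Q.volume_expand_le (Q.measurableSet_iterExpand hA n)
      _ ≤ 2 ^ (d + 1) * (2 ^ ((d + 1) * n) * volume A) := by gcongr
      _ = 2 ^ ((d + 1) * (n + 1)) * volume A := by ring

lemma Cube.sum_weight_iterExpand_le (Q : Cube d) (u : Rd d → ℝ)
    (hu0 : ∀ R : Cube d, weightMeasure u R.set ≠ 0)
    (hutop : ∀ R : Cube d, weightMeasure u R.set ≠ ∞)
    {A : Set (Rd d)} (hA : MeasurableSet A) (hexp : A ⊆ Q.expand A) {N : ℕ}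
    (hN : 2 ^ ((d + 1) * (N + 1)) * volume A ≤ volume Q.set) :
    ∑ j ∈ Finset.range (N + 1), weightMeasure u (Q.iterExpand A (j + 1)) ≤
      2 * FW u * weightMeasure u (Q.iterExpand A (N + 1)) := by
  have hmono := Q.monotone_iterExpand hexp
  have hm := Q.measurableSet_iterExpand hA
  have hdecomp : ∀ j ≤ N, weightMeasure u (Q.iterExpand A (j + 1)) =
      ∑' i : Q.maxGood (Q.iterExpand A N),
        weightMeasure u (Q.iterExpand A (j + 1) ∩ (Q.sub i.1).set) := by
    intro j hj
    have h1 := Q.measure_expand_inter (Q.iterExpand A N) (Q.iterExpand A (j + 1)) (hm _)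
      (weightMeasure u)
    have h2 : Q.expand (Q.iterExpand A N) ∩ Q.iterExpand A (j + 1) = Q.iterExpand A (j + 1) :=
      inter_eq_self_of_subset_right (hmono (Nat.succ_le_succ hj))
    rw [h2] at h1
    rw [h1]
    simp_rw [inter_comm]
  rw [Finset.sum_congr rfl fun j hj => hdecomp j (by simpa [Nat.lt_succ_iff] using hj),
    hdecomp N le_rfl, ← ENNReal.tsum_mul_left,
    ← Summable.tsum_finsetSum fun _ _ => ENNReal.summable]
  refine ENNReal.tsum_le_tsum fun i => ?_
  have hfull : Q.iterExpand A (N + 1) ∩ (Q.sub i.1).set = (Q.sub i.1).set :=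
    inter_eq_self_of_subset_right
      (subset_biUnion_of_mem (u := fun i => (Q.sub i).set) i.2.1)
  have hm' : ∀ j, MeasurableSet
      ((Q.iterExpand A (j + 1) \ Q.iterExpand A j) ∩ (Q.sub i.1).set) := fun j =>
    ((hm _).diff (hm _)).inter (Q.sub i.1).measurableSet
  calc ∑ j ∈ Finset.range (N + 1),
        weightMeasure u (Q.iterExpand A (j + 1) ∩ (Q.sub i.1).set)
      ≤ ∑ j ∈ Finset.range (N + 1),
          2 * ∫⁻ x in (Q.iterExpand A (j + 1) \ Q.iterExpand A j) ∩ (Q.sub i.1).set,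
            maximal ((Q.sub i.1).set.indicator u) x := by
        refine Finset.sum_le_sum fun j hj => ?_
        have hjN : j ≤ N := by simpa [Nat.lt_succ_iff] using hj
        refine Q.weight_expand_inter_le u (hmono hjN) (hm j) ?_ i.2
        calc (2 : ℝ≥0∞) ^ (d + 1) * volume (Q.iterExpand A j)
            ≤ 2 ^ (d + 1) * (2 ^ ((d + 1) * j) * volume A) := by
              gcongr; exact Q.volume_iterExpand_le hA j
          _ = 2 ^ ((d + 1) * (j + 1)) * volume A := by ring
          _ ≤ 2 ^ ((d + 1) * (N + 1)) * volume A := by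
              gcongr; norm_num
          _ ≤ _ := hN
    _ = 2 * ∫⁻ x in ⋃ j ∈ Finset.range (N + 1),
          (Q.iterExpand A (j + 1) \ Q.iterExpand A j) ∩ (Q.sub i.1).set,
            maximal ((Q.sub i.1).set.indicator u) x := by
        rw [lintegral_biUnion_finset, Finset.mul_sum]
        · intro a _ b _ hab
          have key : ∀ a b : ℕ, a < b → Disjoint
              ((Q.iterExpand A (a + 1) \ Q.iterExpand A a) ∩ (Q.sub i.1).set)
              ((Q.iterExpand A (b + 1) \ Q.iterExpand A b) ∩ (Q.sub i.1).set) :=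
            fun a b hab => disjoint_left.2 fun x hx hy =>
              hy.1.2 (hmono (Nat.succ_le_of_lt hab) hx.1.1)
          rcases lt_or_gt_of_ne hab with h | h
          · exact key a b h
          · exact (key b a h).symm
        · exact fun j _ => hm' j
    _ ≤ 2 * ∫⁻ x in (Q.sub i.1).set, maximal ((Q.sub i.1).set.indicator u) x := by
        gcongr
        exact iUnion₂_subset fun _ _ => inter_subset_right
    _ ≤ 2 * (FW u * weightMeasure u (Q.sub i.1).set) := by
        gcongr
        exact lintegral_maximal_le u _ (hu0 _) (hutop _)
    _ = _ := by rw [hfull, mul_assoc]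

/-- The sharp quantitative `A_∞` property of a weight with finite Fujii–Wilson constant. -/
lemma weight_inter_open_le (Q : Cube d) (u : Rd d → ℝ)
    (hu0 : ∀ R : Cube d, weightMeasure u R.set ≠ 0)
    (hutop : ∀ R : Cube d, weightMeasure u R.set ≠ ∞)
    (hFW : FW u ≠ ∞) {U : Set (Rd d)} (hU : IsOpen U) {T : ℝ≥0∞} {n : ℕ}
    (hn : T * (2 * FW u) ≤ n) (q : ℕ)
    (hq : 2 ^ ((d + 1) * (n * q)) * volume (U ∩ Q.set) ≤ volume Q.set) :
    T ^ q * weightMeasure u (U ∩ Q.set) ≤ weightMeasure u Q.set := by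
  set A := U ∩ Q.set with hAdef
  have hA : MeasurableSet A := hU.measurableSet.inter Q.measurableSet
  have hexp : A ⊆ Q.expand A := Q.inter_subset_expand hU
  have hmono := Q.monotone_iterExpand hexp
  have hFW0 : 2 * FW u ≠ 0 :=
    mul_ne_zero two_ne_zero (one_pos.trans_le (one_le_FW u Q (hu0 Q) (hutop Q))).ne'
  have hFWtop : 2 * FW u ≠ ∞ := mul_ne_top ofNat_ne_top hFW
  have key : ∀ r ≤ q, T ^ r * weightMeasure u A ≤ weightMeasure u (Q.iterExpand A (n * r)) := by
    intro r
    induction r with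
    | zero => intro _; simp [Cube.iterExpand]
    | succ r ih =>
      intro hr
      have ih := ih (by omega)
      rcases Nat.eq_zero_or_pos n with rfl | hn0
      · have hT : T = 0 := by
          simpa [hFW0] using hn
        simp [hT]
      obtain ⟨N, hN⟩ : ∃ N, n * (r + 1) = N + 1 :=
        ⟨n * (r + 1) - 1, (Nat.succ_pred_eq_of_pos (by positivity)).symm⟩
      have hsum := Q.sum_weight_iterExpand_le u hu0 hutop hA hexp (N := N) (by
        refine le_trans ?_ hq
        gcongr
        · norm_num
        · rw [← hN]; gcongr)
      rw [← hN] at hsum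
      have hlow : (n : ℝ≥0∞) * weightMeasure u (Q.iterExpand A (n * r)) ≤
          ∑ j ∈ Finset.range (n * (r + 1)), weightMeasure u (Q.iterExpand A (j + 1)) := by
        have hsplit : n * (r + 1) = n * r + n := by ring
        rw [hsplit, Finset.sum_range_add]
        refine le_trans ?_ le_add_self
        calc (n : ℝ≥0∞) * weightMeasure u (Q.iterExpand A (n * r))
            = ∑ _j ∈ Finset.range n, weightMeasure u (Q.iterExpand A (n * r)) := by simp
          _ ≤ _ := Finset.sum_le_sum fun j _ => measure_mono (hmono (by omega))
      have h1 : 2 * FW u * (T * weightMeasure u (Q.iterExpand A (n * r))) ≤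
          2 * FW u * weightMeasure u (Q.iterExpand A (n * (r + 1))) := by
        refine le_trans ?_ (hlow.trans hsum)
        rw [← mul_assoc, mul_comm (2 * FW u)]
        gcongr
      have h2 := (ENNReal.mul_le_mul_iff_right hFW0 hFWtop).1 h1
      refine le_trans ?_ h2
      rw [pow_succ', mul_assoc]
      gcongr
  exact (key q le_rfl).trans (measure_mono (Q.iterExpand_subset inter_subset_right _))

/-- Normalized Lebesgue measure on a cube. -/
def Cube.avgMeasure (Q : Cube d) : Measure (Rd d) := (volume Q.set)⁻¹ • volume.restrict Q.set

lemma Cube.avgMeasure_le_absolutelyContinuous (Q : Cube d) : Q.avgMeasure ≪ volume :=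
  Measure.smul_absolutelyContinuous.trans Measure.restrict_le_self.absolutelyContinuous

lemma Cube.avgMeasure_ne_zero (Q : Cube d) : Q.avgMeasure ≠ 0 := by
  intro h
  have h1 : Q.avgMeasure Q.set = 0 := by rw [h]; rfl
  rw [Cube.avgMeasure, Measure.smul_apply, Measure.restrict_apply_self, smul_eq_mul,
    ENNReal.inv_mul_cancel Q.volume_ne_zero Q.volume_ne_top] at h1
  exact one_ne_zero h1

lemma avg_eq_eLpNorm (g : Rd d → ℝ) {q : ℝ≥0∞} (h0 : q ≠ 0) (htop : q ≠ ∞) (Q : Cube d) :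
    avg g q.toReal Q = eLpNorm g q Q.avgMeasure := by
  rw [eLpNorm_eq_lintegral_rpow_enorm_toReal h0 htop, Cube.avgMeasure, lintegral_smul_measure,
    avg, eAvg, smul_eq_mul]
  simp only [ofFn, Real.enorm_eq_ofReal_abs]

lemma avgE_eq_eLpNorm (g : Rd d → ℝ) {q : ℝ≥0∞} (h0 : q ≠ 0) (Q : Cube d) :
    avgE g q Q = eLpNorm g q Q.avgMeasure := by
  rw [avgE]
  split_ifs with h
  · subst h
    rw [eLpNorm_exponent_top, eLpNormEssSup, Cube.avgMeasure,
      essSup_ennreal_smul_measure (ENNReal.inv_ne_zero.2 Q.volume_ne_top)]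
    simp only [Real.enorm_eq_ofReal_abs]
    rfl
  · exact avg_eq_eLpNorm g h0 h Q

lemma conj_ne_zero {q : ℝ≥0∞} : conj q ≠ 0 :=
  ENNReal.inv_ne_zero.2 (ne_top_of_le_ne_top one_ne_top tsub_le_self)

lemma avg_mul_le (f g : Rd d → ℝ) {q : ℝ≥0∞} (hq : 1 ≤ q) (hf : AEStronglyMeasurable f volume)
    (hg : AEStronglyMeasurable g volume) (Q : Cube d) :
    avg (fun x => f x * g x) 1 Q ≤ avgE f q Q * avgE g (conj q) Q := by
  have hac := Q.avgMeasure_le_absolutelyContinuous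
  have : HolderTriple q (conj q) 1 := ⟨by
    rw [conj, inv_inv, inv_one, add_tsub_cancel_of_le (ENNReal.inv_le_one.2 hq)]⟩
  have h1 := avg_eq_eLpNorm (fun x => f x * g x) one_ne_zero one_ne_top Q
  rw [toReal_one] at h1
  rw [h1, avgE_eq_eLpNorm f (one_pos.trans_le hq).ne', avgE_eq_eLpNorm g conj_ne_zero]
  simpa using eLpNorm_le_eLpNorm_mul_eLpNorm_of_nnnorm (p := q) (q := conj q) (r := 1)
    (hf.mono_ac hac) (hg.mono_ac hac) (fun a b : ℝ => a * b) 1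
    (Filter.Eventually.of_forall fun x => by simp)

lemma avgE_ne_zero {g : Rd d → ℝ} {q : ℝ≥0∞} (hq : q ≠ 0) (hg : AEStronglyMeasurable g volume)
    (hpos : ∀ᵐ x ∂(volume : Measure (Rd d)), 0 < g x) (Q : Cube d) : avgE g q Q ≠ 0 := by
  have hac := Q.avgMeasure_le_absolutelyContinuous
  rw [avgE_eq_eLpNorm g hq, Ne, eLpNorm_eq_zero_iff (hg.mono_ac hac) hq]
  intro h
  have : NeZero Q.avgMeasure := ⟨Q.avgMeasure_ne_zero⟩
  obtain ⟨x, hx0, hx⟩ := (h.and (hac.ae_le hpos)).exists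
  exact hx.ne' hx0

lemma avg_ne_zero {g : Rd d → ℝ} {q : ℝ≥0∞} (hq : q ≠ 0) (hqtop : q ≠ ∞)
    (hg : AEStronglyMeasurable g volume)
    (hpos : ∀ᵐ x ∂(volume : Measure (Rd d)), 0 < g x) (Q : Cube d) : avg g q.toReal Q ≠ 0 := by
  simpa [avgE, hqtop] using avgE_ne_zero hq hg hpos Q

lemma IsWeight.aestronglyMeasurable {u : Rd d → ℝ} (hu : IsWeight u) :
    AEStronglyMeasurable u volume :=
  hu.1.aestronglyMeasurable

lemma aestronglyMeasurable_prodW {w : Fin m → Rd d → ℝ} (hw : ∀ j, IsWeight (w j)) :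
    AEStronglyMeasurable (prodW w) volume :=
  Finset.aestronglyMeasurable_fun_prod _ fun j _ => (hw j).aestronglyMeasurable

lemma prodW_pos {w : Fin m → Rd d → ℝ} (hw : ∀ j, IsWeight (w j)) :
    ∀ᵐ x ∂(volume : Measure (Rd d)), 0 < prodW w x := by
  filter_upwards [ae_all_iff.2 fun j => (hw j).2] with x hx
  exact Finset.prod_pos fun j _ => hx j

lemma prod_avgE_inv_ne_zero {w : Fin m → Rd d → ℝ} (hw : ∀ j, IsWeight (w j)) (p : Fin m → ℝ≥0∞)
    (Q : Cube d) : ∏ j, avgE (fun x => (w j x)⁻¹) (conj (p j)) Q ≠ 0 :=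
  Finset.prod_ne_zero_iff.2 fun j _ => avgE_ne_zero conj_ne_zero
    (hw j).aestronglyMeasurable.aemeasurable.inv.aestronglyMeasurable
    ((hw j).2.mono fun _ hx => inv_pos.2 hx) Q

lemma avg_mul_prod_le_AP (p0 : ℝ) (p : Fin m → ℝ≥0∞) (w : Fin m → Rd d → ℝ) (Q : Cube d) :
    avg (prodW w) p0 Q * ∏ j, avgE (fun x => (w j x)⁻¹) (conj (p j)) Q ≤ AP p0 p w :=
  le_iSup (fun Q : Cube d => avg (prodW w) p0 Q *
    ∏ j, avgE (fun x => (w j x)⁻¹) (conj (p j)) Q) Q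

lemma avg_prodW_ne_top {p0 : ℝ} {p : Fin m → ℝ≥0∞} {w : Fin m → Rd d → ℝ}
    (hw : ∀ j, IsWeight (w j)) (hAP : AP p0 p w ≠ ∞) (Q : Cube d) :
    avg (prodW w) p0 Q ≠ ∞ := by
  intro h
  have h1 := avg_mul_prod_le_AP p0 p w Q
  rw [h, ENNReal.top_mul (prod_avgE_inv_ne_zero hw p Q)] at h1
  exact hAP (top_le_iff.1 h1)

lemma AP_ne_zero {p0 : ℝ≥0∞} (h0 : p0 ≠ 0) (htop : p0 ≠ ∞) (p : Fin m → ℝ≥0∞)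
    {w : Fin m → Rd d → ℝ} (hw : ∀ j, IsWeight (w j)) : AP p0.toReal p w ≠ 0 := by
  intro h
  have h1 := avg_mul_prod_le_AP p0.toReal p w ⟨0, 1, one_pos⟩
  rw [h, le_zero_iff] at h1
  exact mul_ne_zero (avg_ne_zero h0 htop (aestronglyMeasurable_prodW hw) (prodW_pos hw) _)
    (prod_avgE_inv_ne_zero hw p _) h1

lemma weightMeasure_prodW_rpow {w : Fin m → Rd d → ℝ} (hw : ∀ j, IsWeight (w j)) {p0 : ℝ}
    (hp0 : 0 ≤ p0) {A : Set (Rd d)} (hA : MeasurableSet A) :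
    weightMeasure (fun x => prodW w x ^ p0) A = ∫⁻ x in A, ofFn (prodW w) x ^ p0 := by
  rw [weightMeasure, withDensity_apply _ hA]
  refine lintegral_congr_ae (ae_restrict_of_ae ?_)
  filter_upwards [prodW_pos hw] with x hx
  rw [ofFn, abs_of_pos hx, ENNReal.ofReal_rpow_of_nonneg hx.le hp0]

lemma weightMeasure_prodW_cube {w : Fin m → Rd d → ℝ} (hw : ∀ j, IsWeight (w j)) {p0 : ℝ}
    (hp0 : 0 < p0) (Q : Cube d) :
    weightMeasure (fun x => prodW w x ^ p0) Q.set = avg (prodW w) p0 Q ^ p0 * volume Q.set := by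
  rw [weightMeasure_prodW_rpow hw hp0.le Q.measurableSet, avg, eAvg, ← ENNReal.rpow_mul,
    one_div_mul_cancel hp0.ne', ENNReal.rpow_one, mul_right_comm,
    ENNReal.inv_mul_cancel Q.volume_ne_zero Q.volume_ne_top, one_mul]

lemma ennreal_geom_mean_le_arith_mean {ι : Type*} (s : Finset ι) (θ x : ι → ℝ≥0∞)
    (hθ : ∑ i ∈ s, θ i = 1) (hx : ∀ i ∈ s, x i ≠ ∞) :
    ∏ i ∈ s, x i ^ (θ i).toReal ≤ ∑ i ∈ s, θ i * x i := by
  have hθtop : ∀ i ∈ s, θ i ≠ ∞ := fun i hi =>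
    ne_top_of_le_ne_top one_ne_top (hθ ▸ Finset.single_le_sum (fun _ _ => zero_le) hi)
  have h := NNReal.geom_mean_le_arith_mean_weighted s (fun i => (θ i).toNNReal)
    (fun i => (x i).toNNReal) (by
      rw [← ENNReal.toNNReal_sum hθtop, hθ, ENNReal.toNNReal_one])
  calc ∏ i ∈ s, x i ^ (θ i).toReal
      = ((∏ i ∈ s, (x i).toNNReal ^ (((θ i).toNNReal : NNReal) : ℝ) : NNReal) : ℝ≥0∞) := by
        rw [ENNReal.ofNNReal_finsetProd]
        refine Finset.prod_congr rfl fun i hi => ?_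
        rw [ENNReal.coe_rpow_of_nonneg _ NNReal.zero_le_coe, ENNReal.coe_toNNReal (hx i hi)]
        rfl
    _ ≤ ((∑ i ∈ s, (θ i).toNNReal * (x i).toNNReal : NNReal) : ℝ≥0∞) := by exact_mod_cast h
    _ = ∑ i ∈ s, θ i * x i := by
        rw [ENNReal.ofNNReal_finsetSum]
        refine Finset.sum_congr rfl fun i hi => ?_
        rw [ENNReal.coe_mul, ENNReal.coe_toNNReal (hx i hi), ENNReal.coe_toNNReal (hθtop i hi)]

/-- The measure with density `∑ j, (p / p_j) |f_j| ^ p_j`. -/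
def mixMeasure (p0 : ℝ≥0∞) (p : Fin m → ℝ≥0∞) (f : Fin m → Rd d → ℝ) : Measure (Rd d) :=
  volume.withDensity fun x => ∑ j, p0 * (p j)⁻¹ * ‖f j x‖ₑ ^ (p j).toReal

lemma mixMeasure_apply (p0 : ℝ≥0∞) (p : Fin m → ℝ≥0∞) {f : Fin m → Rd d → ℝ}
    (hf : ∀ j, Measurable (f j)) {A : Set (Rd d)} (hA : MeasurableSet A) :
    mixMeasure p0 p f A = ∑ j, p0 * (p j)⁻¹ * ∫⁻ x in A, ‖f j x‖ₑ ^ (p j).toReal := by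
  rw [mixMeasure, withDensity_apply _ hA, lintegral_finsetSum _ fun j _ =>
    (((hf j).enorm.pow_const _).const_mul _)]
  exact Finset.sum_congr rfl fun j _ => lintegral_const_mul _ ((hf j).enorm.pow_const _)

lemma sum_mul_inv_eq_one {p0 : ℝ≥0∞} (h1 : 1 ≤ p0) (htop : p0 ≠ ∞) {p : Fin m → ℝ≥0∞}
    (hp0 : p0⁻¹ = ∑ j, (p j)⁻¹) : ∑ j, p0 * (p j)⁻¹ = 1 := by
  rw [← Finset.mul_sum, ← hp0, ENNReal.mul_inv_cancel (one_pos.trans_le h1).ne' htop]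

lemma lintegral_rpow_of_eLpNorm_eq_one {g : Rd d → ℝ} {q : ℝ≥0∞} (hq : 1 ≤ q) (hqtop : q ≠ ∞)
    (hg : eLpNorm g q volume = 1) : ∫⁻ x, ‖g x‖ₑ ^ q.toReal = 1 := by
  have hq0 : q ≠ 0 := (one_pos.trans_le hq).ne'
  rw [eLpNorm_eq_lintegral_rpow_enorm_toReal hq0 hqtop] at hg
  have := congrArg (fun z : ℝ≥0∞ => z ^ q.toReal) hg
  simpa [← ENNReal.rpow_mul, (ENNReal.toReal_pos hq0 hqtop).ne'] using this

lemma mixMeasure_univ_le {p0 : ℝ≥0∞} (h1 : 1 ≤ p0) (htop : p0 ≠ ∞) {p : Fin m → ℝ≥0∞}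
    (hp : ∀ j, 1 ≤ p j) (hp0 : p0⁻¹ = ∑ j, (p j)⁻¹) {f : Fin m → Rd d → ℝ}
    (hf : ∀ j, Measurable (f j)) (hnorm : ∀ j, eLpNorm (f j) (p j) volume = 1) :
    mixMeasure p0 p f univ ≤ 1 := by
  rw [mixMeasure_apply p0 p hf MeasurableSet.univ, ← sum_mul_inv_eq_one h1 htop hp0]
  refine Finset.sum_le_sum fun j _ => ?_
  by_cases hj : p j = ∞
  · simp [hj]
  · rw [Measure.restrict_univ, lintegral_rpow_of_eLpNorm_eq_one (hp j) hj (hnorm j), mul_one]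

lemma prod_avgE_rpow_le {p0 : ℝ≥0∞} (h1 : 1 ≤ p0) (htop : p0 ≠ ∞) {p : Fin m → ℝ≥0∞}
    (hp : ∀ j, 1 ≤ p j) (hp0 : p0⁻¹ = ∑ j, (p j)⁻¹) {f : Fin m → Rd d → ℝ}
    (hf : ∀ j, Measurable (f j)) (hnorm : ∀ j, eLpNorm (f j) (p j) volume = 1) (Q : Cube d) :
    (∏ j, avgE (f j) (p j) Q) ^ p0.toReal ≤ (volume Q.set)⁻¹ * mixMeasure p0 p f Q.set := by
  set x : Fin m → ℝ≥0∞ := fun j =>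
    (volume Q.set)⁻¹ * ∫⁻ y in Q.set, ‖f j y‖ₑ ^ (p j).toReal with hx
  have hv : (volume Q.set)⁻¹ ≠ ∞ := ENNReal.inv_ne_top.2 Q.volume_ne_zero
  have hxtop : ∀ j ∈ Finset.univ, x j ≠ ∞ := by
    intro j _
    refine mul_ne_top hv ?_
    by_cases hj : p j = ∞
    · simpa [hj] using Q.volume_ne_top
    · exact ne_top_of_le_ne_top one_ne_top
        ((setLIntegral_le_lintegral _ _).trans
          (lintegral_rpow_of_eLpNorm_eq_one (hp j) hj (hnorm j)).le)
  calc (∏ j, avgE (f j) (p j) Q) ^ p0.toReal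
      = ∏ j, avgE (f j) (p j) Q ^ p0.toReal :=
        (ENNReal.prod_rpow_of_nonneg toReal_nonneg).symm
    _ ≤ ∏ j, x j ^ (p0 * (p j)⁻¹).toReal := by
        refine Finset.prod_le_prod' fun j _ => ?_
        by_cases hj : p j = ∞
        · have h2 : avgE (f j) (p j) Q ≤ 1 := by
            rw [avgE_eq_eLpNorm _ (one_pos.trans_le (hp j)).ne', hj, eLpNorm_exponent_top]
            refine (eLpNormEssSup_mono_measure _ Q.avgMeasure_le_absolutelyContinuous).trans ?_
            rw [← eLpNorm_exponent_top, ← hj, hnorm j]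
          simpa [hj] using ENNReal.rpow_le_rpow h2 (toReal_nonneg (a := p0))
        · refine le_of_eq ?_
          rw [avgE, if_neg hj, avg, eAvg, ← ENNReal.rpow_mul, toReal_mul, toReal_inv,
            one_div, mul_comm p0.toReal]
          simp only [hx, ofFn, Real.enorm_eq_ofReal_abs]
    _ ≤ ∑ j, p0 * (p j)⁻¹ * x j :=
        ennreal_geom_mean_le_arith_mean _ _ _ (sum_mul_inv_eq_one h1 htop hp0) hxtop
    _ = (volume Q.set)⁻¹ * mixMeasure p0 p f Q.set := by
        rw [mixMeasure_apply p0 p hf Q.measurableSet, Finset.mul_sum]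
        exact Finset.sum_congr rfl fun j _ => by simp only [hx]; ring

lemma setLIntegral_le_rpow_mul_rpow {g : Rd d → ℝ≥0∞} (hg : AEMeasurable g volume)
    (A : Set (Rd d)) {q : ℝ} (hq : 1 ≤ q) :
    ∫⁻ x in A, g x ≤ (∫⁻ x in A, g x ^ q) ^ (1 / q) * volume A ^ (1 - 1 / q) := by
  rcases hq.eq_or_lt with rfl | hq
  · simp
  have h := ENNReal.lintegral_mul_le_Lp_mul_Lq (volume.restrict A)
    (Real.HolderConjugate.conjExponent hq) hg.restrict (aemeasurable_const (b := (1 : ℝ≥0∞)))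
  have h2 : 1 / q.conjExponent = 1 - 1 / q := by
    have := (Real.HolderConjugate.conjExponent hq).inv_add_inv_eq_one
    rw [one_div, one_div]; linarith
  simpa [h2] using h

lemma sparse_term_le {p0 : ℝ≥0∞} (h1 : 1 ≤ p0) (htop : p0 ≠ ∞) {p : Fin m → ℝ≥0∞}
    (hp : ∀ j, 1 ≤ p j) (hp0 : p0⁻¹ = ∑ j, (p j)⁻¹)
    {w : Fin m → Rd d → ℝ} (hw : ∀ j, IsWeight (w j))
    {f : Fin m → Rd d → ℝ} (hf : ∀ j, Measurable (f j))
    (hnorm : ∀ j, eLpNorm (f j) (p j) volume = 1) (Q : Cube d)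
    {U E : Set (Rd d)} (hU : MeasurableSet U) (hE : MeasurableSet E) (hEU : E ⊆ U) {L s : ℝ≥0∞}
    (q : ℕ)
    (hmix : mixMeasure p0 p f Q.set ≤ L * s * volume Q.set)
    (hvol : volume (U ∩ Q.set) ≤ s * volume Q.set)
    (hwt : (2 ^ p0.toReal) ^ q * weightMeasure (fun x => prodW w x ^ p0.toReal) (U ∩ Q.set) ≤
      weightMeasure (fun x => prodW w x ^ p0.toReal) Q.set) :
    2 ^ q * ((∏ j, avg (fun x => f j x * (w j x)⁻¹) 1 Q) * avg (E.indicator (prodW w)) 1 Q *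
      volume Q.set) ≤ AP p0.toReal p w * L ^ (p0.toReal)⁻¹ * s * volume Q.set := by
  set P := p0.toReal with hP
  have hP1 : 1 ≤ P := by
    rw [hP, ← toReal_one]; exact ENNReal.toReal_mono htop h1
  have hP0 : 0 < P := one_pos.trans_le hP1
  set a := avg (prodW w) P Q with ha
  set F := ∏ j, avgE (f j) (p j) Q with hF
  set B := ∏ j, avgE (fun x => (w j x)⁻¹) (conj (p j)) Q with hB
  set v := volume Q.set with hv
  have hv0 : v ≠ 0 := Q.volume_ne_zero
  have hvtop : v ≠ ∞ := Q.volume_ne_top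
  have hexp : 0 ≤ 1 - 1 / P := by
    rw [sub_nonneg, div_le_one hP0]; exact hP1
  have hsplit : ∀ z : ℝ≥0∞, z ^ P⁻¹ * z ^ (1 - 1 / P) = z := fun z => by
    rw [← ENNReal.rpow_add_of_nonneg _ _ (inv_nonneg.2 hP0.le) hexp, one_div,
      add_sub_cancel, ENNReal.rpow_one]
  have hprod : ∏ j, avg (fun x => f j x * (w j x)⁻¹) 1 Q ≤ F * B := by
    rw [hF, hB, ← Finset.prod_mul_distrib]
    exact Finset.prod_le_prod' fun j _ => avg_mul_le (f j) (fun x => (w j x)⁻¹) (hp j)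
      (hf j).aestronglyMeasurable
      (hw j).aestronglyMeasurable.aemeasurable.inv.aestronglyMeasurable Q
  have hFle : F ≤ L ^ P⁻¹ * s ^ P⁻¹ := by
    have h2 : F ^ P ≤ L * s := by
      refine (prod_avgE_rpow_le h1 htop hp hp0 hf hnorm Q).trans ?_
      rw [← ENNReal.div_eq_inv_mul]
      exact ENNReal.div_le_of_le_mul hmix
    rw [← ENNReal.mul_rpow_of_nonneg _ _ (inv_nonneg.2 hP0.le)]
    exact (ENNReal.le_rpow_inv_iff hP0).2 h2
  have hmass : avg (E.indicator (prodW w)) 1 Q * v ≤ ∫⁻ x in U ∩ Q.set, ofFn (prodW w) x := by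
    rw [avg_one, mul_right_comm, ENNReal.inv_mul_cancel hv0 hvtop, one_mul]
    have h2 : ofFn (E.indicator (prodW w)) = E.indicator (ofFn (prodW w)) := by
      ext x; by_cases hx : x ∈ E <;> simp [ofFn, hx]
    rw [h2, lintegral_indicator hE, Measure.restrict_restrict hE]
    exact lintegral_mono_set (inter_subset_inter_left _ hEU)
  have hmeas : AEMeasurable (ofFn (prodW w)) volume :=
    (aestronglyMeasurable_prodW hw).aemeasurable.abs.ennreal_ofReal
  have hw1 : 2 ^ q * (∫⁻ x in U ∩ Q.set, ofFn (prodW w) x ^ P) ^ (1 / P) ≤ a * v ^ P⁻¹ := by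
    rw [← weightMeasure_prodW_rpow hw hP0.le (hU.inter Q.measurableSet)]
    have h2 := ENNReal.rpow_le_rpow hwt (inv_nonneg.2 hP0.le)
    rw [weightMeasure_prodW_cube hw hP0, ENNReal.mul_rpow_of_nonneg _ _ (inv_nonneg.2 hP0.le),
      ENNReal.mul_rpow_of_nonneg _ _ (inv_nonneg.2 hP0.le), ← ENNReal.rpow_natCast,
      ← ENNReal.rpow_mul, ← ENNReal.rpow_mul, ← ENNReal.rpow_mul, mul_inv_cancel₀ hP0.ne',
      ENNReal.rpow_one, mul_comm P, mul_assoc, inv_mul_cancel₀ hP0.ne', mul_one,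
      ENNReal.rpow_natCast] at h2
    rwa [one_div]
  calc 2 ^ q * ((∏ j, avg (fun x => f j x * (w j x)⁻¹) 1 Q) *
        avg (E.indicator (prodW w)) 1 Q * v)
      ≤ 2 ^ q * (F * B * ((∫⁻ x in U ∩ Q.set, ofFn (prodW w) x ^ P) ^ (1 / P) *
          (s * v) ^ (1 - 1 / P))) := by
        rw [mul_assoc (∏ j, _)]
        refine mul_le_mul' le_rfl (mul_le_mul' hprod
          (hmass.trans ((setLIntegral_le_rpow_mul_rpow hmeas _ hP1).trans ?_)))
        gcongr
    _ = F * B * (2 ^ q * (∫⁻ x in U ∩ Q.set, ofFn (prodW w) x ^ P) ^ (1 / P)) *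
          (s * v) ^ (1 - 1 / P) := by ring
    _ ≤ (L ^ P⁻¹ * s ^ P⁻¹) * B * (a * v ^ P⁻¹) * (s * v) ^ (1 - 1 / P) := by gcongr
    _ = (a * B) * L ^ P⁻¹ * (s ^ P⁻¹ * s ^ (1 - 1 / P)) * (v ^ P⁻¹ * v ^ (1 - 1 / P)) := by
        rw [ENNReal.mul_rpow_of_nonneg _ _ hexp]; ring
    _ ≤ AP P p w * L ^ P⁻¹ * s * v := by
        rw [hsplit, hsplit]
        gcongr
        exact avg_mul_prod_le_AP P p w Q

lemma tsum_inv_two_pow_div {N : ℕ} (hN : N ≠ 0) :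
    ∑' k : ℕ, (2⁻¹ : ℝ≥0∞) ^ (k / N) = 2 * N := by
  have : NeZero N := ⟨hN⟩
  rw [← (Nat.divModEquiv N).symm.tsum_eq]
  have h : ∀ a : ℕ × Fin N, (2⁻¹ : ℝ≥0∞) ^ ((Nat.divModEquiv N).symm a / N) = 2⁻¹ ^ a.1 := by
    rintro ⟨a, b⟩
    congr 1
    exact congrArg Prod.fst ((Nat.divModEquiv N).apply_symm_apply (a, b))
  simp_rw [h]
  rw [ENNReal.tsum_prod (f := fun a (_ : Fin N) => (2⁻¹ : ℝ≥0∞) ^ a)]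
  simp_rw [tsum_fintype, Finset.sum_const, Finset.card_univ, Fintype.card_fin, nsmul_eq_mul]
  rw [ENNReal.tsum_mul_left, ENNReal.tsum_geometric, ENNReal.one_sub_inv_two, inv_inv, mul_comm]

lemma exists_inv_two_pow_mul_lt_le {z v : ℝ≥0∞} (hz : z ≠ 0) (hzv : z ≤ v) (hv : v ≠ ∞) :
    ∃ k : ℕ, 2⁻¹ ^ (k + 1) * v < z ∧ z ≤ 2⁻¹ ^ k * v := by
  have hztop : z ≠ ∞ := ne_top_of_le_ne_top hv hzv
  have hz0 : 0 < z.toReal := ENNReal.toReal_pos hz hztop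
  have hzv' : z.toReal ≤ v.toReal := ENNReal.toReal_mono hv hzv
  have hv0 : 0 < v.toReal := hz0.trans_le hzv'
  obtain ⟨k, hk1, hk2⟩ := exists_nat_pow_near_of_lt_one (x := z.toReal / v.toReal) (y := 2⁻¹)
    (div_pos hz0 hv0) ((div_le_one hv0).2 hzv') (by norm_num) (by norm_num)
  have hpow : ∀ n : ℕ, (2⁻¹ : ℝ≥0∞) ^ n * v = ENNReal.ofReal (2⁻¹ ^ n * v.toReal) := fun n => by
    rw [ENNReal.ofReal_mul (by positivity), ENNReal.ofReal_toReal hv,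
      ENNReal.ofReal_pow (by positivity), ENNReal.ofReal_inv_of_pos two_pos, ENNReal.ofReal_ofNat]
  refine ⟨k, ?_, ?_⟩
  · rw [hpow, ENNReal.ofReal_lt_iff_lt_toReal (by positivity) hztop]
    exact (lt_div_iff₀ hv0).1 hk1
  · rw [hpow, ENNReal.le_ofReal_iff_toReal_le hztop (by positivity)]
    exact (div_le_iff₀ hv0).1 hk2

/-- If each nonzero term is controlled at a scale `2⁻ᵏ` at which `κ` is large on the cube, the
weak-type bound sums the terms over a sparse family. -/
lemma IsSparse.tsum_le_of_scales (hd : 1 ≤ d) {η : ℝ} (hη : 0 < η) {S : Set (Cube d)}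
    (hS : IsSparse η S) (κ : Measure (Rd d)) [IsFiniteMeasure κ] {N : ℕ} (hN : N ≠ 0)
    {τ : Cube d → ℝ≥0∞} {C : ℝ≥0∞}
    (h : ∀ Q ∈ S, τ Q ≠ 0 → ∃ k : ℕ, 2⁻¹ ^ (k + 1) * volume Q.set < κ Q.set ∧
      2 ^ (k / N) * τ Q ≤ C * 2⁻¹ ^ k * volume Q.set) :
    ∑' Q : S, τ Q ≤ C * ((ENNReal.ofReal η)⁻¹ * (5 ^ d * 2 * κ univ)) * (2 * N) := by
  classical
  set P : ℕ → Cube d → Prop := fun k Q => 2⁻¹ ^ (k + 1) * volume Q.set < κ Q.set with hP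
  have hcancel : ∀ n : ℕ, (2 : ℝ≥0∞) ^ n * 2⁻¹ ^ n = 1 := fun n => by
    rw [← mul_pow, ENNReal.mul_inv_cancel two_ne_zero ofNat_ne_top, one_pow]
  have hterm : ∀ Q : S, τ Q ≤
      ∑' k : ℕ, C * 2⁻¹ ^ k * 2⁻¹ ^ (k / N) * (if P k Q.1 then volume Q.1.set else 0) := by
    intro Q
    by_cases hQ : τ Q = 0
    · simp [hQ]
    obtain ⟨k, hk1, hk2⟩ := h Q.1 Q.2 hQ
    refine le_trans ?_ (ENNReal.le_tsum k)
    rw [if_pos (show P k Q.1 from hk1)]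
    calc τ Q = 2⁻¹ ^ (k / N) * (2 ^ (k / N) * τ Q) := by
          rw [← mul_assoc, mul_comm (2⁻¹ ^ (k / N)), hcancel, one_mul]
      _ ≤ 2⁻¹ ^ (k / N) * (C * 2⁻¹ ^ k * volume Q.1.set) := by gcongr
      _ = _ := by ring
  have hscale : ∀ k : ℕ, ∑' Q : S, (if P k Q.1 then volume Q.1.set else 0) ≤
      (ENNReal.ofReal η)⁻¹ * (5 ^ d * 2 ^ (k + 1) * κ univ) := by
    intro k
    refine (hS.tsum_volume_le hη (P k)).trans ?_
    have := volume_iUnion_cubes_le hd κ (2⁻¹ ^ (k + 1)) (pow_ne_zero _ (by simp)) (by finiteness)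
    rw [ENNReal.inv_pow, inv_inv] at this
    gcongr
  calc ∑' Q : S, τ Q
      ≤ ∑' Q : S, ∑' k : ℕ,
          C * 2⁻¹ ^ k * 2⁻¹ ^ (k / N) * (if P k Q.1 then volume Q.1.set else 0) :=
        ENNReal.tsum_le_tsum hterm
    _ = ∑' k : ℕ, C * 2⁻¹ ^ k * 2⁻¹ ^ (k / N) *
          ∑' Q : S, (if P k Q.1 then volume Q.1.set else 0) := by
        rw [ENNReal.tsum_comm]
        simp_rw [ENNReal.tsum_mul_left]
    _ ≤ ∑' k : ℕ, C * ((ENNReal.ofReal η)⁻¹ * (5 ^ d * 2 * κ univ)) * 2⁻¹ ^ (k / N) := by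
        refine ENNReal.tsum_le_tsum fun k => (mul_le_mul' le_rfl (hscale k)).trans_eq ?_
        calc _ = C * ((ENNReal.ofReal η)⁻¹ * (5 ^ d * 2 * κ univ)) * 2⁻¹ ^ (k / N) *
              (2 ^ k * 2⁻¹ ^ k) := by ring
          _ = _ := by rw [hcancel, mul_one]
    _ = C * ((ENNReal.ofReal η)⁻¹ * (5 ^ d * 2 * κ univ)) * (2 * N) := by
        rw [ENNReal.tsum_mul_left, tsum_inv_two_pow_div hN]

lemma avg_indicator_eq_zero {A : Set (Rd d)} (g : Rd d → ℝ) {Q : Cube d}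
    (h : ∀ x ∈ Q.set, x ∉ A) : avg (A.indicator g) 1 Q = 0 := by
  rw [avg_one, setLIntegral_congr_fun Q.measurableSet
    (g := fun _ => 0) fun x hx => by simp [ofFn, h x hx]]
  simp

lemma volume_le_volume_sdiff_of_inv {E A : Set (Rd d)} {x : ℝ} (hx : 0 < x)
    (hE : volume E ≠ ∞) (hA : volume A ≤ (ENNReal.ofReal x)⁻¹ * volume E) :
    ENNReal.ofReal (1 - x⁻¹) * volume E ≤ volume (E \ A) := by
  rw [ENNReal.ofReal_sub _ (inv_nonneg.2 hx.le), ENNReal.ofReal_one,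
    ENNReal.ofReal_inv_of_pos hx, ENNReal.sub_mul fun _ _ => hE, one_mul]
  exact (tsub_le_tsub_left hA _).trans le_measure_sdiff

lemma rpow_inv_mul_inv_mul_self {z a : ℝ≥0∞} (hz0 : z ≠ 0) (hz : z ≠ ∞) {P : ℝ} (hP : 0 < P) :
    (a * z⁻¹) ^ P⁻¹ * z = a ^ P⁻¹ * z ^ (1 - P⁻¹) := by
  rw [ENNReal.mul_rpow_of_nonneg _ _ (inv_nonneg.2 hP.le), ENNReal.inv_rpow, ← ENNReal.rpow_neg,
    mul_assoc, sub_eq_neg_add, ENNReal.rpow_add _ _ hz0 hz, ENNReal.rpow_one]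

/-- The sparse sum over a set `E` whose traces avoid the cubes of large mixed mass. -/
lemma sparse_sum_le (hd : 1 ≤ d) {p0 : ℝ≥0∞} (h1 : 1 ≤ p0) (htop : p0 ≠ ∞) {p : Fin m → ℝ≥0∞}
    (hp : ∀ j, 1 ≤ p j) (hp0 : p0⁻¹ = ∑ j, (p j)⁻¹)
    {w : Fin m → Rd d → ℝ} (hw : ∀ j, IsWeight (w j)) (hAP : AP p0.toReal p w ≠ ∞)
    (hFW : FW (fun x => prodW w x ^ p0.toReal) ≠ ∞)
    {f : Fin m → Rd d → ℝ} (hf : ∀ j, Measurable (f j))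
    (hnorm : ∀ j, eLpNorm (f j) (p j) volume = 1)
    {U E : Set (Rd d)} (hU : IsOpen U) (hUtop : volume U ≠ ∞) (hE : MeasurableSet E) (hEU : E ⊆ U)
    {L : ℝ≥0∞} (hL0 : L ≠ 0) (hL : L ≠ ∞)
    (hEL : ∀ Q : Cube d, L * volume Q.set < mixMeasure p0 p f Q.set → ∀ x ∈ Q.set, x ∉ E)
    {η : ℝ} (hη : 0 < η) {S : Set (Cube d)} (hS : IsSparse η S) :
    ∑' Q : S, (∏ j, avg (fun x => f j x * (w j x)⁻¹) 1 Q.1) * avg (E.indicator (prodW w)) 1 Q.1 *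
        volume Q.1.set ≤
      AP p0.toReal p w * L ^ (p0.toReal)⁻¹ *
        ((ENNReal.ofReal η)⁻¹ * (5 ^ d * 2 * (L⁻¹ + volume U))) *
        (2 * ((d + 1) * ((2 ^ p0.toReal * 2 + 1) * FW (fun x => prodW w x ^ p0.toReal)))) := by
  set P := p0.toReal with hP
  set u : Rd d → ℝ := fun x => prodW w x ^ P with hu
  set ν := mixMeasure p0 p f with hν
  have hP0 : 0 < P := ENNReal.toReal_pos (one_pos.trans_le h1).ne' htop
  have hu0 : ∀ R : Cube d, weightMeasure u R.set ≠ 0 := fun R => by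
    rw [hu, weightMeasure_prodW_cube hw hP0]
    refine mul_ne_zero (fun h => ?_) R.volume_ne_zero
    exact avg_ne_zero (one_pos.trans_le h1).ne' htop (aestronglyMeasurable_prodW hw)
      (prodW_pos hw) R ((ENNReal.rpow_eq_zero_iff_of_pos hP0).1 h)
  have hutop : ∀ R : Cube d, weightMeasure u R.set ≠ ∞ := fun R => by
    rw [hu, weightMeasure_prodW_cube hw hP0]
    exact mul_ne_top (ENNReal.rpow_ne_top_of_nonneg hP0.le (avg_prodW_ne_top hw hAP R))
      R.volume_ne_top
  have hFW1 : 1 ≤ FW u := one_le_FW u ⟨0, 1, one_pos⟩ (hu0 _) (hutop _)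
  have h2P : (2 : ℝ≥0∞) ^ P ≠ ∞ := ENNReal.rpow_ne_top_of_nonneg hP0.le ofNat_ne_top
  have h2P1 : 1 ≤ (2 : ℝ≥0∞) ^ P := ENNReal.one_le_rpow one_le_two hP0
  have hTtop : (2 : ℝ≥0∞) ^ P * (2 * FW u) ≠ ∞ := by finiteness
  obtain ⟨n, hn, hn'⟩ : ∃ n : ℕ, (2 : ℝ≥0∞) ^ P * (2 * FW u) ≤ n ∧
      (n : ℝ≥0∞) ≤ 2 ^ P * (2 * FW u) + 1 := by
    lift (2 : ℝ≥0∞) ^ P * (2 * FW u) to NNReal using hTtop with T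
    exact ⟨⌈T⌉₊, by exact_mod_cast Nat.le_ceil T, by exact_mod_cast (Nat.ceil_lt_add_one T.2).le⟩
  have hn0 : n ≠ 0 := by
    rintro rfl
    rw [Nat.cast_zero, le_zero_iff] at hn
    exact (mul_ne_zero (one_pos.trans_le h2P1).ne'
      (mul_ne_zero two_ne_zero (one_pos.trans_le hFW1).ne')) hn
  have hνuniv : ν univ ≤ 1 := mixMeasure_univ_le h1 htop hp hp0 hf hnorm
  set κ : Measure (Rd d) := L⁻¹ • ν + volume.restrict U with hκ
  have hκ_apply : ∀ A, MeasurableSet A → κ A = L⁻¹ * ν A + volume (U ∩ A) := fun A hA => by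
    rw [hκ, Measure.add_apply, Measure.smul_apply, smul_eq_mul, Measure.restrict_apply hA,
      inter_comm]
  have hκuniv : κ univ ≤ L⁻¹ + volume U := by
    rw [hκ_apply _ MeasurableSet.univ, inter_univ]
    gcongr
    exact mul_le_of_le_one_right' hνuniv
  have hLinv : L⁻¹ ≠ ∞ := ENNReal.inv_ne_top.2 hL0
  have : IsFiniteMeasure κ := ⟨hκuniv.trans_lt (by finiteness)⟩
  refine (hS.tsum_le_of_scales hd hη κ (N := (d + 1) * n)
    (τ := fun Q => (∏ j, avg (fun x => f j x * (w j x)⁻¹) 1 Q) *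
      avg (E.indicator (prodW w)) 1 Q * volume Q.set)
    (C := AP P p w * L ^ P⁻¹) (mul_ne_zero (Nat.succ_ne_zero d) hn0) ?_).trans ?_
  · intro Q _ hQ
    have hνQ : L⁻¹ * ν Q.set ≤ volume Q.set := by
      rw [← ENNReal.div_eq_inv_mul]
      refine ENNReal.div_le_of_le_mul' (not_lt.1 fun h => hQ ?_)
      simp only [avg_indicator_eq_zero _ (hEL Q h), mul_zero, zero_mul]
    have hmix : ∀ s : ℝ≥0∞, L⁻¹ * ν Q.set ≤ s * volume Q.set →
        ν Q.set ≤ L * s * volume Q.set := fun s hs => by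
      rw [mul_assoc]
      calc ν Q.set = L * (L⁻¹ * ν Q.set) := by
            rw [← mul_assoc, ENNReal.mul_inv_cancel hL0 hL, one_mul]
        _ ≤ _ := by gcongr
    have hz : max (L⁻¹ * ν Q.set) (volume (U ∩ Q.set)) ≠ 0 := by
      intro hz
      rw [← bot_eq_zero, max_eq_bot, bot_eq_zero] at hz
      have h := sparse_term_le h1 htop hp hp0 hw hf hnorm Q hU.measurableSet hE hEU (L := L)
        (s := 0) 0 (hmix 0 (by rw [hz.1]; exact zero_le)) (by rw [hz.2]; exact zero_le)
        (by rw [pow_zero, one_mul]; exact measure_mono inter_subset_right)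
      rw [pow_zero, one_mul, mul_zero, zero_mul, le_zero_iff] at h
      exact hQ h
    obtain ⟨k, hk1, hk2⟩ := exists_inv_two_pow_mul_lt_le hz
      (max_le hνQ (measure_mono inter_subset_right)) Q.volume_ne_top
    rw [max_le_iff] at hk2
    refine ⟨k, ?_, sparse_term_le h1 htop hp hp0 hw hf hnorm Q hU.measurableSet hE hEU _
      (hmix _ hk2.1) hk2.2 (weight_inter_open_le Q u hu0 hutop hFW hU hn _ ?_)⟩
    · rw [hκ_apply _ Q.measurableSet]
      exact hk1.trans_le (max_le le_self_add le_add_self)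
    · have hle : (d + 1) * (n * (k / ((d + 1) * n))) ≤ k := by
        rw [← mul_assoc]; exact Nat.mul_div_le _ _
      calc (2 : ℝ≥0∞) ^ ((d + 1) * (n * (k / ((d + 1) * n)))) * volume (U ∩ Q.set)
          ≤ 2 ^ k * (2⁻¹ ^ k * volume Q.set) :=
            mul_le_mul' (pow_le_pow_right₀ one_le_two hle) hk2.2
        _ = volume Q.set := by
            rw [← mul_assoc, ← mul_pow, ENNReal.mul_inv_cancel two_ne_zero ofNat_ne_top, one_pow,
              one_mul]
  · have hN : (n : ℝ≥0∞) ≤ (2 ^ P * 2 + 1) * FW u := by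
      rw [add_mul, one_mul, mul_assoc]
      exact hn'.trans (by gcongr)
    push_cast
    gcongr

/-- The key estimate in the proof of Theorem B, case `p ≥ 1`. -/
theorem stmt13 (d m : ℕ) (hd : 1 ≤ d) (hm : 1 ≤ m)
    (p : Fin m → ℝ≥0∞) (hp : ∀ j, 1 ≤ p j)
    (p0 : ℝ≥0∞) (hp0ge : 1 ≤ p0) (hp0top : p0 ≠ ∞) (hp0 : p0⁻¹ = ∑ j, (p j)⁻¹) :
    ∃ c : ℝ≥0∞, c ≠ ∞ ∧
      ∀ w : Fin m → Rd d → ℝ, (∀ j, IsWeight (w j)) →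
        AP p0.toReal p w ≠ ∞ →
        ∀ f : Fin m → Rd d → ℝ, (∀ j, Measurable (f j)) → (∀ j x, 0 ≤ f j x) →
          (∀ j, eLpNorm (f j) (p j) volume = 1) →
          ∀ E : Set (Rd d), MeasurableSet E → 0 < volume E → volume E < ∞ →
            ∀ D : Set (Cube d), IsDyadicGrid D →
              ∃ E' : Set (Rd d), E' ⊆ E ∧ MeasurableSet E' ∧
                ENNReal.ofReal (1 - (2 * 3 ^ d : ℝ)⁻¹) * volume E ≤ volume E' ∧
                ∀ S : Set (Cube d), S ⊆ D → IsSparse ((2 * 6 ^ d : ℝ))⁻¹ S →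
                  (∑' Q : S,
                      (∏ j, avg (fun x => f j x * (w j x)⁻¹) 1 Q.1) *
                        avg (E'.indicator (prodW w)) 1 Q.1 * volume (Q.1).set) ≤
                    c * FW (fun x => prodW w x ^ p0.toReal) * AP p0.toReal p w *
                      volume E ^ (1 - (p0.toReal)⁻¹) := by
  have hd3 : (0 : ℝ) < 2 * 3 ^ d := by positivity
  set P := p0.toReal with hP
  have hP0 : 0 < P := ENNReal.toReal_pos (one_pos.trans_le hp0ge).ne' hp0top
  set η : ℝ := (2 * 6 ^ d : ℝ)⁻¹ with hη
  have hη0 : 0 < η := by positivity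
  set a : ℝ≥0∞ := 5 ^ d * ENNReal.ofReal (2 * 3 ^ d) with ha
  have ha0 : a ≠ 0 := mul_ne_zero (pow_ne_zero _ (by simp)) (ENNReal.ofReal_pos.2 hd3).ne'
  have hatop : a ≠ ∞ := by finiteness
  have ha1 : 1 ≤ a := one_le_mul (one_le_pow₀ (by norm_num))
    (ENNReal.one_le_ofReal.2 (by nlinarith [one_le_pow₀ (n := d) (show (1 : ℝ) ≤ 3 by norm_num)]))
  set b : ℝ≥0∞ := (ENNReal.ofReal η)⁻¹ * (5 ^ d * 2 * 3) with hb
  have hηinv : (ENNReal.ofReal η)⁻¹ ≠ ∞ := ENNReal.inv_ne_top.2 (ENNReal.ofReal_pos.2 hη0).ne'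
  have hηinv0 : (ENNReal.ofReal η)⁻¹ ≠ 0 := ENNReal.inv_ne_zero.2 ofReal_ne_top
  set e : ℝ≥0∞ := 2 * ((d + 1) * (2 ^ P * 2 + 1)) with he
  have haP : a ^ P⁻¹ ≠ ∞ := ENNReal.rpow_ne_top_of_nonneg (inv_nonneg.2 hP0.le) hatop
  have haP0 : a ^ P⁻¹ ≠ 0 := (ENNReal.rpow_pos (pos_iff_ne_zero.2 ha0) hatop).ne'
  have h2P : (2 : ℝ≥0∞) ^ P ≠ ∞ := ENNReal.rpow_ne_top_of_nonneg hP0.le ofNat_ne_top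
  refine ⟨a ^ P⁻¹ * b * e, by finiteness, ?_⟩
  intro w hw hAP f hf _ hnorm E hE hE0 hEtop D _
  set V := volume E with hV
  set ν := mixMeasure p0 p f with hν
  have hνuniv : ν univ ≤ 1 := mixMeasure_univ_le hp0ge hp0top hp hp0 hf hnorm
  have : IsFiniteMeasure ν := ⟨hνuniv.trans_lt one_lt_top⟩
  set L : ℝ≥0∞ := a * V⁻¹ with hL
  have hL0 : L ≠ 0 := mul_ne_zero ha0 (ENNReal.inv_ne_zero.2 hEtop.ne)
  have hLtop : L ≠ ∞ := mul_ne_top hatop (ENNReal.inv_ne_top.2 hE0.ne')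
  have hLinv : L⁻¹ = a⁻¹ * V := by
    rw [hL, ENNReal.mul_inv (Or.inl ha0) (Or.inl hatop), inv_inv]
  set Ω : Set (Rd d) := ⋃ Q ∈ {Q : Cube d | L * volume Q.set < ν Q.set}, Q.set with hΩ
  have hΩvol : volume (toMeasurable volume Ω) ≤ (ENNReal.ofReal (2 * 3 ^ d))⁻¹ * V := by
    rw [measure_toMeasurable]
    refine (volume_iUnion_cubes_le hd ν L hL0 hLtop).trans ?_
    calc 5 ^ d * L⁻¹ * ν univ ≤ 5 ^ d * L⁻¹ * 1 := by gcongr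
      _ = (5 ^ d * (5 ^ d)⁻¹) * (ENNReal.ofReal (2 * 3 ^ d))⁻¹ * V := by
          rw [hLinv, ha, ENNReal.mul_inv (Or.inr ofReal_ne_top)
            (Or.inl (by finiteness)), mul_one]
          ring
      _ = _ := by rw [ENNReal.mul_inv_cancel (pow_ne_zero _ (by simp)) (by finiteness), one_mul]
  refine ⟨E \ toMeasurable volume Ω, sdiff_subset, hE.diff (measurableSet_toMeasurable _ _),
    volume_le_volume_sdiff_of_inv hd3 hEtop.ne hΩvol, ?_⟩
  intro S _ hS
  by_cases hFW : FW (fun x => prodW w x ^ P) = ∞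
  · have he0 : e ≠ 0 := by simp [he]
    have hb0 : b ≠ 0 := mul_ne_zero hηinv0 (by simp)
    rw [hFW, ENNReal.mul_top (mul_ne_zero (mul_ne_zero haP0 hb0) he0),
      ENNReal.top_mul (AP_ne_zero (one_pos.trans_le hp0ge).ne' hp0top p hw),
      ENNReal.top_mul (ENNReal.rpow_pos hE0 hEtop.ne).ne']
    exact le_top
  obtain ⟨U, hEU, hU, hUV⟩ := Set.exists_isOpen_lt_of_lt E (2 * V)
    (by simpa [two_mul] using ENNReal.lt_add_right hEtop.ne hE0.ne')
  have hmass : L⁻¹ + volume U ≤ 3 * V := by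
    calc L⁻¹ + volume U ≤ 1 * V + 2 * V := by
          rw [hLinv]
          gcongr
          exact ENNReal.inv_le_one.2 ha1
      _ = 3 * V := by ring
  have hsum := sparse_sum_le hd hp0ge hp0top hp hp0 hw hAP hFW hf hnorm hU hUV.ne_top
    (hE.diff (measurableSet_toMeasurable volume Ω)) (sdiff_subset.trans hEU) hL0 hLtop
    (fun Q hQ x hx hxE => hxE.2 (subset_toMeasurable volume Ω (mem_iUnion₂_of_mem hQ hx))) hη0 hS
  calc _ ≤ AP P p w * L ^ P⁻¹ * ((ENNReal.ofReal η)⁻¹ * (5 ^ d * 2 * (3 * V))) *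
        (2 * ((d + 1) * ((2 ^ P * 2 + 1) * FW (fun x => prodW w x ^ P)))) :=
        hsum.trans (by gcongr)
    _ = (L ^ P⁻¹ * V) * b * e * FW (fun x => prodW w x ^ P) * AP P p w := by
        rw [hb, he]; ring
    _ = a ^ P⁻¹ * b * e * FW (fun x => prodW w x ^ P) * AP P p w * V ^ (1 - P⁻¹) := by
        rw [hL, rpow_inv_mul_inv_mul_self hE0.ne' hEtop.ne hP0]; ring

end Paper
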